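/- If m is an odd integer and G is a connected finite simple graph with maximum degree Δ(G) ≥ 4, and n is an integer with 1 < m < n, then χ(G^{m/n}) ≤ ω(G^{m/n}) + 2. -/

import Mathlib

open SimpleGraph

/-- Representations of vertices of the `n`-subdivision of `G`: `(u, u, 0)` represents the
branch vertex `u`, and for an adjacent pair `(u, v)`, the triple `(u, v, i)` with `i ≤ n`
represents the point at distance `i` from `u` on the path of length `n` replacing the
edge `uv`. -/
def SubdivPre {V : Type*} (G : SimpleGraph V) (n : ℕ) : Type _ :=
  {p : V × V × ℕ // (p.1 = p.2.1 ∧ p.2.2 = 0) ∨ (G.Adj p.1 p.2.1 ∧ p.2.2 ≤ n)}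

/-- The identifications between representations: `(u, v, i)` and `(v, u, n - i)` represent
the same point, and `(u, v, 0)` represents the branch vertex `u`, i.e. `(u, u, 0)`. -/
inductive SubdivRel {V : Type*} (G : SimpleGraph V) (n : ℕ) :
    SubdivPre G n → SubdivPre G n → Prop
  | flip (u v : V) (i : ℕ) (h : G.Adj u v) (hi : i ≤ n) :
      SubdivRel G n ⟨(u, v, i), Or.inr ⟨h, hi⟩⟩
        ⟨(v, u, n - i), Or.inr ⟨h.symm, Nat.sub_le n i⟩⟩
  | collapse (u v : V) (h : G.Adj u v) :
      SubdivRel G n ⟨(u, v, 0), Or.inr ⟨h, Nat.zero_le n⟩⟩ ⟨(u, u, 0), Or.inl ⟨rfl, rfl⟩⟩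

/-- The vertex set of the `n`-subdivision of `G`. -/
def SubdivVert {V : Type*} (G : SimpleGraph V) (n : ℕ) : Type _ := Quot (SubdivRel G n)

/-- The branch vertex of the subdivision corresponding to a vertex `u` of `G`. -/
def branchVertex {V : Type*} (G : SimpleGraph V) (n : ℕ) (u : V) : SubdivVert G n :=
  Quot.mk _ ⟨(u, u, 0), Or.inl ⟨rfl, rfl⟩⟩

/-- The vertex `(uv)_i` of the subdivision: the point at distance `i` from `u` on the
path of length `n` replacing the edge `uv`. -/
def mkVert {V : Type*} (G : SimpleGraph V) (n : ℕ) {u v : V} (h : G.Adj u v)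
    (i : ℕ) (hi : i ≤ n) : SubdivVert G n :=
  Quot.mk _ ⟨(u, v, i), Or.inr ⟨h, hi⟩⟩

/-- The `n`-subdivision `G^{1/n}` of `G`: each edge of `G` is replaced by a path of
length `n`; consecutive points on such a path are adjacent. -/
def subdivision {V : Type*} (G : SimpleGraph V) (n : ℕ) : SimpleGraph (SubdivVert G n) :=
  SimpleGraph.fromRel (fun x y => ∃ (u v : V) (h : G.Adj u v) (i : ℕ) (hi : i < n),
    x = mkVert G n h i (le_of_lt hi) ∧ y = mkVert G n h (i + 1) hi)

/-- The `m`-power of a graph: two distinct vertices are adjacent iff their distance is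
at most `m`, i.e. iff there is a walk of length at most `m` between them. -/
def powerGraph {W : Type*} (H : SimpleGraph W) (m : ℕ) : SimpleGraph W :=
  SimpleGraph.fromRel (fun x y => ∃ w : H.Walk x y, w.length ≤ m)

/-- The fractional power `G^{m/n}`, the `m`-power of the `n`-subdivision of `G`. -/
def fracPower {V : Type*} (G : SimpleGraph V) (m n : ℕ) : SimpleGraph (SubdivVert G n) :=
  powerGraph (subdivision G n) m

section FracAux

/-- An integer matrix with constant line sums `d` is covered by `d` permutations. -/
theorem exists_perms_cover {X : Type*} [Fintype X] [DecidableEq X] (d : ℕ) :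
    ∀ M : X → X → ℕ, (∀ x, ∑ y, M x y = d) → (∀ y, ∑ x, M x y = d) →
    ∃ σ : Fin d → Equiv.Perm X, ∀ x y, 0 < M x y → ∃ i, σ i x = y := by
  induction d with
  | zero =>
    intro M h1 _
    refine ⟨fun i => i.elim0, fun x y h => ?_⟩
    have := h1 x
    rw [Finset.sum_eq_zero_iff] at this
    have := this y (Finset.mem_univ _)
    omega
  | succ d ih =>
    intro M h1 h2
    have hall : ∀ S : Finset X, S.card ≤
        (S.biUnion (fun x => Finset.univ.filter (fun y => 0 < M x y))).card := by
      intro S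
      set N := S.biUnion (fun x => Finset.univ.filter (fun y => 0 < M x y)) with hN
      have e1 : ∑ x ∈ S, ∑ y ∈ N, M x y = S.card * (d + 1) := by
        rw [Finset.sum_const_nat]
        intro x hx
        rw [← h1 x]
        apply Finset.sum_subset (Finset.subset_univ _)
        intro y _ hy
        by_contra hne
        apply hy
        rw [hN, Finset.mem_biUnion]
        exact ⟨x, hx, by simp; omega⟩
      have e2 : ∑ x ∈ S, ∑ y ∈ N, M x y ≤ N.card * (d + 1) := by
        rw [Finset.sum_comm]
        calc ∑ y ∈ N, ∑ x ∈ S, M x y ≤ ∑ y ∈ N, (d + 1) := by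
              apply Finset.sum_le_sum
              intro y _
              rw [← h2 y]
              exact Finset.sum_le_sum_of_subset (Finset.subset_univ _)
          _ = _ := by simp
      exact Nat.le_of_mul_le_mul_right (e1 ▸ e2) (Nat.succ_pos d)
    obtain ⟨f, finj, hf⟩ :=
      (Finset.all_card_le_biUnion_card_iff_exists_injective _).1 hall
    let τ : Equiv.Perm X := Equiv.ofBijective f (Finite.injective_iff_bijective.1 finj)
    have hτ : ∀ x, 0 < M x (τ x) := fun x => by
      have := hf x
      simpa [τ] using this
    have hle : ∀ x y, (if τ x = y then 1 else 0) ≤ M x y := by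
      intro x y
      split_ifs with h
      · subst h; exact hτ x
      · exact Nat.zero_le _
    obtain ⟨σ, hσ⟩ := ih (fun x y => M x y - if τ x = y then 1 else 0)
      (by
        intro x
        rw [Finset.sum_tsub_distrib _ (fun y _ => hle x y), h1]
        simp)
      (by
        intro y
        rw [Finset.sum_tsub_distrib _ (fun x _ => hle x y), h2]
        have : ∀ x, (τ x = y) = (x = τ.symm y) := fun x => by
          rw [Equiv.eq_symm_apply]
        simp [this])
    refine ⟨Fin.cons τ σ, fun x y h => ?_⟩
    by_cases hxy : τ x = y
    · exact ⟨0, by simpa using hxy⟩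
    · obtain ⟨i, hi⟩ := hσ x y (by simpa [hxy] using h)
      exact ⟨i.succ, by simpa using hi⟩

/-- Half-edge labelling: König edge colouring of the bipartite graph `G^{1/2}`. -/
theorem exists_labelling {V : Type*} [Fintype V] (G : SimpleGraph V)
    [DecidableRel G.Adj] (D : ℕ) (hD : 2 ≤ D) (hdeg : ∀ v, G.degree v ≤ D) :
    ∃ f : V → V → Fin D, (∀ u v w, G.Adj u v → G.Adj u w → v ≠ w → f u v ≠ f u w) ∧
      (∀ u v, G.Adj u v → f u v ≠ f v u) := by
  classical
  let I : V → Sym2 V → ℕ := fun v e => if e ∈ G.edgeSet ∧ v ∈ e then 1 else 0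
  have hrow : ∀ v, ∑ e, I v e ≤ D := by
    intro v
    refine le_trans ?_ (hdeg v)
    rw [← G.card_incidenceFinset_eq_degree]
    simp only [I]
    rw [Finset.sum_boole, Nat.cast_id]
    apply Finset.card_le_card
    intro e he
    simpa [SimpleGraph.mem_incidenceFinset, SimpleGraph.incidenceSet] using he
  have hcol : ∀ e, ∑ v, I v e ≤ D := by
    intro e
    refine le_trans ?_ hD
    simp only [I]
    rw [Finset.sum_boole, Nat.cast_id]
    induction e with
    | _ a b =>
      refine le_trans (Finset.card_le_card (t := {a, b}) ?_) Finset.card_le_two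
      intro v hv
      simpa using (by simpa using hv : _ ∧ _).2
  let M : V ⊕ Sym2 V → V ⊕ Sym2 V → ℕ := fun x y =>
    match x, y with
    | Sum.inl v, Sum.inr e => I v e
    | Sum.inl v, Sum.inl w => if v = w then D - ∑ e, I v e else 0
    | Sum.inr e, Sum.inl v => I v e
    | Sum.inr e, Sum.inr e' => if e = e' then D - ∑ v, I v e else 0
  obtain ⟨σ, hσ⟩ := exists_perms_cover D M
    (by
      rintro (v | e)
      · simp only [Fintype.sum_sum_type, M]
        have := hrow v
        simp
        omega
      · simp only [Fintype.sum_sum_type, M]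
        have := hcol e
        simp
        omega)
    (by
      rintro (v | e)
      · simp only [Fintype.sum_sum_type, M]
        have := hrow v
        simp
        omega
      · simp only [Fintype.sum_sum_type, M]
        have := hcol e
        simp
        omega)
  have key : ∀ u v, ∃ i : Fin D, G.Adj u v → σ i (Sum.inl u) = Sum.inr s(u, v) := by
    intro u v
    by_cases h : G.Adj u v
    · obtain ⟨i, hi⟩ := hσ (Sum.inl u) (Sum.inr s(u, v)) (by simp [M, I, h])
      exact ⟨i, fun _ => hi⟩
    · exact ⟨⟨0, by omega⟩, fun h' => absurd h' h⟩
  choose f hf using key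
  refine ⟨f, fun u v w huv huw hne heq => ?_, fun u v huv heq => ?_⟩
  · have h1 := hf u v huv
    have h2 := hf u w huw
    rw [heq, h2] at h1
    have := Sum.inr.inj h1
    rw [Sym2.congr_right] at this
    exact hne this.symm
  · have h1 := hf u v huv
    have h2 := hf v u huv.symm
    rw [heq] at h1
    rw [Sym2.eq_swap, ← h1] at h2
    exact huv.ne (Sum.inl.inj ((σ _).injective h2)).symm

/-- The periodic part of the word colouring an edge. -/
def wBase {L : Type*} (k : ℕ) (a b : L) (x : ℕ) : Fin 4 ⊕ (L × ℕ) :=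
  if x = 0 then Sum.inl 0 else if x ≤ k then Sum.inr (a, x) else
    if x = k + 1 then Sum.inl 1 else Sum.inr (b, 2 * k + 2 - x)

/-- The inserted part of the word colouring an edge. -/
def wIns {L : Type*} (k r : ℕ) (c d : L) (e : ℕ) : Fin 4 ⊕ (L × ℕ) :=
  if e = r then Sum.inl 2 else if 2 * e < r then Sum.inr (c, k + 1 - e) else
    if 2 * e = r then Sum.inl 3 else Sum.inr (d, k + 1 + e - r)

/-- The word colouring an edge of length `P + (2k+2) + r`. -/
def wWord {L : Type*} (k P r : ℕ) (a b c d : L) (i : ℕ) : Fin 4 ⊕ (L × ℕ) :=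
  if i ≤ P + k + 1 then wBase k a b (i % (2 * k + 2)) else
    if i ≤ P + k + 1 + r then wIns k r c d (i - (P + k + 1)) else
      wBase k a b ((i - r) % (2 * k + 2))

theorem wBase_inj {L : Type*} (k : ℕ) (a b : L) (hab : a ≠ b) (x y : ℕ)
    (hx : x < 2 * k + 2) (hy : y < 2 * k + 2) (h : wBase k a b x = wBase k a b y) : x = y := by
  unfold wBase at h
  split_ifs at h <;> simp_all <;> omega

theorem wIns_inj {L : Type*} (k r : ℕ) (c d : L) (hcd : c ≠ d) (hr : r ≤ 2 * k + 1) (x y : ℕ)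
    (hx : x ≤ r) (hy : y ≤ r) (h : wIns k r c d x = wIns k r c d y) : x = y := by
  unfold wIns at h
  split_ifs at h <;> simp_all <;> omega

theorem wBase_ne_wIns {L : Type*} (k r : ℕ) (a b c d : L) (hac : a ≠ c) (had : a ≠ d)
    (hbc : b ≠ c) (hbd : b ≠ d) (x y : ℕ) : wBase k a b x ≠ wIns k r c d y := by
  intro h
  unfold wBase wIns at h
  split_ifs at h <;> simp_all

theorem mod_gap {M x y : ℕ} (hxy : x < y) (h : x % M = y % M) : x + M ≤ y := by
  have h1 : M ∣ y - x := (Nat.modEq_iff_dvd' hxy.le).1 h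
  have := Nat.le_of_dvd (by omega) h1
  omega

theorem wWord_gap {L : Type*} (k P r : ℕ) (a b c d : L) (hab : a ≠ b) (hac : a ≠ c)
    (had : a ≠ d) (hbc : b ≠ c) (hbd : b ≠ d) (hcd : c ≠ d) (hr : r ≤ 2 * k + 1) (i j : ℕ)
    (hij : i < j) (h : wWord k P r a b c d i = wWord k P r a b c d j) :
    i + (2 * k + 2) ≤ j := by
  have hM : 0 < 2 * k + 2 := by omega
  have hne := wBase_ne_wIns k r a b c d hac had hbc hbd
  unfold wWord at h
  split_ifs at h with h1 h2 h3 h4 h5 h6 h7 h8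
  all_goals first
    | exact absurd h (hne _ _)
    | exact absurd h.symm (hne _ _)
    | omega
    | (have h' := wIns_inj k r c d hcd hr _ _ (by omega) (by omega) h
       omega)
    | (have h' := wBase_inj k a b hab _ _ (Nat.mod_lt _ hM) (Nat.mod_lt _ hM) h
       have := mod_gap (by omega) h'
       omega)

theorem wWord_zero {L : Type*} (k P r : ℕ) (a b c d : L) :
    wWord k P r a b c d 0 = Sum.inl 0 := by
  simp [wWord, wBase]

theorem wWord_last {L : Type*} (k q r : ℕ) (a b c d : L) :
    wWord k ((2 * k + 2) * q) r a b c d ((2 * k + 2) * q + (2 * k + 2) + r) = Sum.inl 0 := by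
  unfold wWord
  rw [if_neg (by omega), if_neg (by omega), Nat.add_sub_cancel]
  simp [wBase]

theorem wWord_start {L : Type*} (k P r : ℕ) (a b c d : L) (i : ℕ) (h1 : 1 ≤ i) (h2 : i ≤ k) :
    wWord k P r a b c d i = Sum.inr (a, i) := by
  unfold wWord wBase
  rw [if_pos (by omega), Nat.mod_eq_of_lt (by omega), if_neg (by omega), if_pos h2]

theorem wWord_end {L : Type*} (k q r : ℕ) (a b c d : L) (i : ℕ) (h1 : 1 ≤ i) (h2 : i ≤ k) :
    wWord k ((2 * k + 2) * q) r a b c d ((2 * k + 2) * q + (2 * k + 2) + r - i) =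
      Sum.inr (b, i) := by
  unfold wWord wBase
  rw [if_neg (by omega), if_neg (by omega)]
  have : (2 * k + 2) * q + (2 * k + 2) + r - i - r = (2 * k + 2 - i) + (2 * k + 2) * q := by omega
  rw [this, Nat.add_mul_mod_self_left, Nat.mod_eq_of_lt (by omega), if_neg (by omega),
    if_neg (by omega), if_neg (by omega)]
  simp; omega

theorem wWord_left {L : Type*} (k P r : ℕ) (a b c d : L) (j : ℕ) (l : L) (t : ℕ)
    (hl : l ≠ a) (h : wWord k P r a b c d j = Sum.inr (l, t)) : 2 * k + 2 ≤ j + t := by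
  unfold wWord wBase wIns at h
  have h1 := Nat.mod_le j (2 * k + 2)
  have h2 := Nat.mod_le (j - r) (2 * k + 2)
  split_ifs at h <;> simp at h <;> first | omega | (exact absurd h.1.symm hl)

theorem wWord_right {L : Type*} (k q r : ℕ) (a b c d : L) (j : ℕ) (l : L) (t : ℕ)
    (hl : l ≠ b) (hj : j ≤ (2 * k + 2) * q + (2 * k + 2) + r)
    (h : wWord k ((2 * k + 2) * q) r a b c d ((2 * k + 2) * q + (2 * k + 2) + r - j)
      = Sum.inr (l, t)) : 2 * k + 2 ≤ j + t := by
  by_contra hlt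
  push Not at hlt
  unfold wWord at h
  split_ifs at h with h1 h2
  · have : (2 * k + 2) * q + (2 * k + 2) + r - j = (2 * k + 2 + r - j) + (2 * k + 2) * q := by
      omega
    rw [this, Nat.add_mul_mod_self_left, Nat.mod_eq_of_lt (by omega)] at h
    unfold wBase at h
    split_ifs at h <;> simp at h <;> first | omega | (exact absurd h.1.symm hl)
  · unfold wIns at h
    split_ifs at h <;> simp at h <;> omega
  · have : (2 * k + 2) * q + (2 * k + 2) + r - j - r = (2 * k + 2 - j) + (2 * k + 2) * q := by
      omega
    rw [this, Nat.add_mul_mod_self_left] at h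
    rcases Nat.eq_zero_or_pos j with rfl | hj0
    · simp [wBase] at h
    · rw [Nat.mod_eq_of_lt (by omega)] at h
      unfold wBase at h
      split_ifs at h <;> simp at h <;> first | omega | (exact absurd h.1.symm hl)

theorem wWord_good {L : Type*} (k P r : ℕ) (a b c d : L) (hr : r ≤ 2 * k + 1) (i : ℕ) (l : L)
    (t : ℕ) (h : wWord k P r a b c d i = Sum.inr (l, t)) : 1 ≤ t ∧ t ≤ k := by
  have hM : 0 < 2 * k + 2 := by omega
  have h1 := Nat.mod_lt i hM
  have h2 := Nat.mod_lt (i - r) hM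
  unfold wWord wBase wIns at h
  split_ifs at h <;> simp at h <;> omega


/-- Lifting a function on representations to the subdivision. -/
def subdivLift {V : Type*} {G : SimpleGraph V} {n : ℕ} {C : Type*} (F : V → V → ℕ → C)
    (h1 : ∀ u v i, G.Adj u v → i ≤ n → F u v i = F v u (n - i))
    (h2 : ∀ u v, G.Adj u v → F u v 0 = F u u 0) : SubdivVert G n → C :=
  Quot.lift (fun p => F p.1.1 p.1.2.1 p.1.2.2) (by
    intro x y h
    cases h with
    | flip u v i h hi => exact h1 u v i h hi
    | collapse u v h => exact h2 u v h)

/-- Normal form of a representation. -/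
def nForm {V : Type*} (o : V → ℕ) (n : ℕ) (u v : V) (i : ℕ) : V × V × ℕ :=
  if i = 0 then (u, u, 0) else if i = n then (v, v, 0) else
    if o u < o v then (u, v, i) else (v, u, n - i)

theorem mkVert_inv {V : Type*} [Fintype V] {G : SimpleGraph V} {n : ℕ} (hn : 0 < n)
    {u v u' v' : V} (h : G.Adj u v) (h' : G.Adj u' v') {i i' : ℕ} (hi : i ≤ n) (hi' : i' ≤ n)
    (he : mkVert G n h i hi = mkVert G n h' i' hi') :
    (u = u' ∧ v = v' ∧ i = i') ∨ (u = v' ∧ v = u' ∧ i + i' = n) ∨ (u = u' ∧ i = 0 ∧ i' = 0) ∨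
    (v = u' ∧ i = n ∧ i' = 0) ∨ (u = v' ∧ i = 0 ∧ i' = n) ∨ (v = v' ∧ i = n ∧ i' = n) := by
  let o : V → ℕ := fun v => (Fintype.equivFin V v).val
  have ho : ∀ a b, o a = o b → a = b := fun a b hab =>
    (Fintype.equivFin V).injective (Fin.ext hab)
  have key : nForm o n u v i = nForm o n u' v' i' := by
    refine congrArg (subdivLift (G := G) (n := n) (nForm o n) ?_ ?_) he
    · intro u v i h hi
      have : o u ≠ o v := fun hh => h.ne (ho _ _ hh)
      unfold nForm
      split_ifs <;> first | rfl | omega | (simp; omega)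
    · intro u v h
      simp [nForm]
  unfold nForm at key
  split_ifs at key <;> simp only [Prod.mk.injEq] at key <;> grind

theorem mkVert_flip {V : Type*} {G : SimpleGraph V} {n : ℕ} {u v : V} (h : G.Adj u v) {i : ℕ}
    (hi : i ≤ n) : mkVert G n h i hi = mkVert G n h.symm (n - i) (Nat.sub_le n i) :=
  Quot.sound (SubdivRel.flip u v i h hi)

theorem mkVert_zero {V : Type*} {G : SimpleGraph V} {n : ℕ} {u v w : V} (h : G.Adj u v)
    (h' : G.Adj u w) :
    mkVert G n h 0 (Nat.zero_le n) = mkVert G n h' 0 (Nat.zero_le n) :=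
  (Quot.sound (SubdivRel.collapse u v h)).trans (Quot.sound (SubdivRel.collapse u w h')).symm

theorem mkVert_congr {V : Type*} {G : SimpleGraph V} {n : ℕ} {u v : V} (h : G.Adj u v) {i j : ℕ}
    (hi : i ≤ n) (hj : j ≤ n) (hij : i = j) : mkVert G n h i hi = mkVert G n h j hj := by
  subst hij; rfl

theorem mkVert_last {V : Type*} {G : SimpleGraph V} {n : ℕ} {u v w : V} (h : G.Adj u v)
    (h' : G.Adj v w) :
    mkVert G n h n le_rfl = mkVert G n h' 0 (Nat.zero_le n) := by
  rw [mkVert_flip, ← mkVert_zero h.symm h']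
  exact mkVert_congr _ _ _ (by omega)

theorem exists_rep {V : Type*} {G : SimpleGraph V} {n : ℕ} (hG : ∀ u, ∃ v, G.Adj u v)
    (x : SubdivVert G n) : ∃ (u v : V) (h : G.Adj u v) (i : ℕ) (hi : i ≤ n),
      x = mkVert G n h i hi := by
  induction x using Quot.ind with
  | _ p =>
    obtain ⟨⟨u, v, i⟩, hp⟩ := p
    rcases hp with ⟨h1, h2⟩ | ⟨h1, h2⟩
    · simp only at h1 h2
      subst h1 h2
      obtain ⟨w, hw⟩ := hG u
      exact ⟨u, w, hw, 0, Nat.zero_le _, (Quot.sound (SubdivRel.collapse u w hw)).symm⟩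
    · exact ⟨u, v, h1, i, h2, rfl⟩

theorem step_lemma {V : Type*} [Fintype V] {G : SimpleGraph V} {n : ℕ} (hn : 0 < n)
    {u w : V} (h : G.Adj u w) {j : ℕ} (hj : j ≤ n) {y : SubdivVert G n}
    (ha : (subdivision G n).Adj (mkVert G n h j hj) y) :
    (∃ (j' : ℕ) (hj' : j' ≤ n), (j' = j + 1 ∨ j = j' + 1) ∧ y = mkVert G n h j' hj') ∨
    (j = 0 ∧ ∃ (z : V) (hz : G.Adj u z), y = mkVert G n hz 1 hn) ∨
    (j = n ∧ ∃ (z : V) (hz : G.Adj w z), y = mkVert G n hz 1 hn) := by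
  have main : ∃ (a b : V) (hab : G.Adj a b) (i i' : ℕ) (hi : i ≤ n) (hi' : i' ≤ n),
      (i' = i + 1 ∨ i = i' + 1) ∧
      mkVert G n h j hj = mkVert G n hab i hi ∧ y = mkVert G n hab i' hi' := by
    rw [subdivision, SimpleGraph.fromRel_adj] at ha
    rcases ha.2 with ⟨a, b, hab, i, hi, h1, h2⟩ | ⟨a, b, hab, i, hi, h1, h2⟩
    · exact ⟨a, b, hab, i, i + 1, _, _, Or.inl rfl, h1, h2⟩
    · exact ⟨a, b, hab, i + 1, i, _, _, Or.inr rfl, h2, h1⟩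
  obtain ⟨a, b, hab, i, i', hi, hi', hii, h1, rfl⟩ := main
  rcases mkVert_inv hn h hab hj hi h1 with ⟨rfl, rfl, rfl⟩ | ⟨rfl, rfl, hs⟩ | ⟨rfl, h3, h4⟩ |
    ⟨rfl, h3, h4⟩ | ⟨rfl, h3, h4⟩ | ⟨rfl, h3, h4⟩
  · exact Or.inl ⟨i', hi', hii, rfl⟩
  · exact Or.inl ⟨n - i', Nat.sub_le _ _, by omega, mkVert_flip _ _⟩
  · exact Or.inr (Or.inl ⟨h3, b, hab, mkVert_congr _ _ _ (by omega)⟩)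
  · exact Or.inr (Or.inr ⟨h3, b, hab, mkVert_congr _ _ _ (by omega)⟩)
  · refine Or.inr (Or.inl ⟨h3, a, hab.symm, ?_⟩)
    rw [mkVert_flip]; exact mkVert_congr _ _ _ (by omega)
  · refine Or.inr (Or.inr ⟨h3, a, hab.symm, ?_⟩)
    rw [mkVert_flip]; exact mkVert_congr _ _ _ (by omega)

theorem walk_lemma {V : Type*} [Fintype V] {G : SimpleGraph V} {n : ℕ} (hn : 0 < n)
    (hG : ∀ u, ∃ v, G.Adj u v) {x y : SubdivVert G n} (p : (subdivision G n).Walk x y)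
    (hp : p.length < n) :
    ∃ (u v w : V) (hv : G.Adj u v) (hw : G.Adj u w) (i j : ℕ) (hi : i ≤ n) (hj : j ≤ n),
      x = mkVert G n hv i hi ∧ y = mkVert G n hw j hj ∧
      (i + j ≤ p.length ∨ (v = w ∧ i ≤ j + p.length ∧ j ≤ i + p.length)) := by
  induction p with
  | nil =>
    rename_i z
    obtain ⟨u, v, h, i, hi, rfl⟩ := exists_rep hG z
    exact ⟨u, v, v, h, h, i, i, hi, hi, rfl, rfl, Or.inr ⟨rfl, by simp, by simp⟩⟩
  | @cons x' x y ha p ih =>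
    rw [SimpleGraph.Walk.length_cons] at hp ⊢
    obtain ⟨u, v, w, hv, hw, i, j, hi, hj, rfl, rfl, hd⟩ := ih (by omega)
    rcases step_lemma hn hv hi ha.symm with ⟨i', hi', hii, rfl⟩ | ⟨h0, z, hz, rfl⟩ |
      ⟨h0, z, hz, rfl⟩
    · refine ⟨u, v, w, hv, hw, i', j, hi', hj, rfl, rfl, ?_⟩
      rcases hd with hd | ⟨hvw, hd⟩
      · left; omega
      · exact Or.inr ⟨hvw, by omega⟩
    · exact ⟨u, z, w, hz, hw, 1, j, hn, hj, rfl, rfl, by omega⟩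
    · rcases hd with hd | ⟨rfl, hd⟩
      · omega
      · refine ⟨v, z, u, hz, hv.symm, 1, n - j, hn, Nat.sub_le _ _, rfl, mkVert_flip _ _, ?_⟩
        omega

/-- Colour of the point `(u, v, i)`. -/
def fCol {V L : Type*} (o : V → ℕ) (f : V → V → L) (c d : L → L → L) (k P r n : ℕ)
    (u v : V) (i : ℕ) : Fin 4 ⊕ (L × ℕ) :=
  if o u < o v then wWord k P r (f u v) (f v u) (c (f u v) (f v u)) (d (f u v) (f v u)) i
  else wWord k P r (f v u) (f u v) (c (f v u) (f u v)) (d (f v u) (f u v)) (n - i)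

theorem coloring_upper {V : Type*} [Fintype V] (G : SimpleGraph V) [DecidableRel G.Adj]
    (hG : ∀ u, ∃ v, G.Adj u v) (D : ℕ) (hD : 4 ≤ D) (hdeg : ∀ v, G.degree v ≤ D)
    (k n : ℕ) (hk : 1 ≤ k) (hn : 2 * k + 2 ≤ n) :
    (fracPower G (2 * k + 1) n).Colorable (k * D + 4) := by
  obtain ⟨f, hf1, hf2⟩ := exists_labelling G D (by omega) hdeg
  have hcd : ∀ a b : Fin D, ∃ c d : Fin D, a ≠ c ∧ a ≠ d ∧ b ≠ c ∧ b ≠ d ∧ c ≠ d := by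
    intro a b
    have h1 : 1 < (Finset.univ \ {a, b} : Finset (Fin D)).card := by
      have := Finset.le_card_sdiff ({a, b} : Finset (Fin D)) Finset.univ
      have h2 : ({a, b} : Finset (Fin D)).card ≤ 2 := Finset.card_le_two
      rw [Finset.card_univ, Fintype.card_fin] at this
      omega
    obtain ⟨c, hc, d, hd, hne⟩ := Finset.one_lt_card.1 h1
    simp at hc hd
    exact ⟨c, d, fun h => hc.1 h.symm, fun h => hd.1 h.symm, fun h => hc.2 h.symm,
      fun h => hd.2 h.symm, hne⟩
  choose c d hcd using hcd
  let o : V → ℕ := fun v => (Fintype.equivFin V v).val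
  have ho : ∀ a b, o a = o b → a = b := fun a b hab =>
    (Fintype.equivFin V).injective (Fin.ext hab)
  obtain ⟨q, r, hr, rfl⟩ : ∃ q r, r ≤ 2 * k + 1 ∧ n = (2 * k + 2) * q + (2 * k + 2) + r := by
    refine ⟨(n - (2 * k + 2)) / (2 * k + 2), (n - (2 * k + 2)) % (2 * k + 2), ?_, ?_⟩
    · have := Nat.mod_lt (n - (2 * k + 2)) (show 0 < 2 * k + 2 by omega)
      omega
    · have := Nat.div_add_mod (n - (2 * k + 2)) (2 * k + 2)
      omega
  set P := (2 * k + 2) * q with hP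
  set n := P + (2 * k + 2) + r with hnn
  let F := fCol o f c d k P r n
  have F0 : ∀ u v, F u v 0 = Sum.inl 0 := by
    intro u v
    simp only [F, fCol]
    split_ifs
    · exact wWord_zero _ _ _ _ _ _ _
    · exact wWord_last _ _ _ _ _ _ _
  have Fflip : ∀ u v i, G.Adj u v → i ≤ n → F u v i = F v u (n - i) := by
    intro u v i h hi
    have : o u ≠ o v := fun hh => h.ne (ho _ _ hh)
    simp only [F, fCol]
    split_ifs
    · omega
    · rw [Nat.sub_sub_self hi]
    · rfl
    · omega
  have Fgap : ∀ u v i j, G.Adj u v → i < j → j ≤ n → F u v i = F u v j →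
      i + (2 * k + 2) ≤ j := by
    intro u v i j h hij hj he
    simp only [F, fCol] at he
    split_ifs at he
    · obtain ⟨h1, h2, h3, h4, h5⟩ := hcd (f u v) (f v u)
      exact wWord_gap k P r _ _ _ _ (hf2 _ _ h) h1 h2 h3 h4 h5 hr i j hij he
    · obtain ⟨h1, h2, h3, h4, h5⟩ := hcd (f v u) (f u v)
      have := wWord_gap k P r _ _ _ _ (hf2 _ _ h.symm) h1 h2 h3 h4 h5 hr (n - j) (n - i)
        (by omega) he.symm
      omega
  have Fstart : ∀ u v i, 1 ≤ i → i ≤ k → F u v i = Sum.inr (f u v, i) := by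
    intro u v i h1 h2
    simp only [F, fCol]
    split_ifs
    · exact wWord_start _ _ _ _ _ _ _ _ h1 h2
    · exact wWord_end _ _ _ _ _ _ _ _ h1 h2
  have Fleft : ∀ u v j l t, j ≤ n → l ≠ f u v → F u v j = Sum.inr (l, t) →
      2 * k + 2 ≤ j + t := by
    intro u v j l t hj hl he
    simp only [F, fCol] at he
    split_ifs at he
    · exact wWord_left k P r _ _ _ _ j l t hl he
    · exact wWord_right k q r _ _ _ _ j l t hl hj he
  have Fgood : ∀ u v i l t, F u v i = Sum.inr (l, t) → 1 ≤ t ∧ t ≤ k := by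
    intro u v i l t he
    simp only [F, fCol] at he
    split_ifs at he
    · exact wWord_good k P r _ _ _ _ hr _ l t he
    · exact wWord_good k P r _ _ _ _ hr _ l t he
  -- the star condition
  have Fstar : ∀ u v w i j, G.Adj u v → G.Adj u w → v ≠ w → i ≤ j → j ≤ n →
      i + j ≤ 2 * k + 1 → F u v i = F u w j → i = 0 ∧ j = 0 := by
    intro u v w i j hv hw hne hij hj hs he
    rcases Nat.eq_zero_or_pos i with rfl | hi
    · refine ⟨rfl, ?_⟩
      by_contra hj0
      rw [F0, ← F0 u w] at he
      have := Fgap u w 0 j hw (by omega) hj he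
      omega
    · exfalso
      rw [Fstart u v i hi (by omega)] at he
      have := Fleft u w j _ _ hj (hf1 u v w hv hw hne) he.symm
      omega
  let φ : SubdivVert G n → Fin 4 ⊕ (Fin D × ℕ) :=
    subdivLift F Fflip (fun u v _ => by rw [F0, F0])
  have hφ : ∀ u v (h : G.Adj u v) i (hi : i ≤ n), φ (mkVert G n h i hi) = F u v i :=
    fun _ _ _ _ _ => rfl
  let g : Fin 4 ⊕ (Fin D × ℕ) → Fin 4 ⊕ (Fin D × Fin k) :=
    Sum.map id (Prod.map id (fun t => ⟨(t - 1) % k, Nat.mod_lt _ hk⟩))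
  have hg : ∀ u v i u' v' i', g (F u v i) = g (F u' v' i') → F u v i = F u' v' i' := by
    intro u v i u' v' i' he
    rcases h1 : F u v i with s | ⟨l, t⟩ <;> rcases h2 : F u' v' i' with s' | ⟨l', t'⟩ <;>
      rw [h1, h2] at he
    · simpa [g] using he
    · simp [g] at he
    · simp [g] at he
    · have ht := Fgood _ _ _ _ _ h1
      have ht' := Fgood _ _ _ _ _ h2
      simp only [g, Sum.map_inr, Prod.map_apply, id, Sum.inr.injEq, Prod.mk.injEq,
        Fin.mk.injEq] at he
      rw [Nat.mod_eq_of_lt (by omega), Nat.mod_eq_of_lt (by omega)] at he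
      rw [he.1, show t = t' by omega]
  have hwalk : ∀ x y : SubdivVert G n, x ≠ y →
      (∃ p : (subdivision G n).Walk x y, p.length ≤ 2 * k + 1) → g (φ x) ≠ g (φ y) := by
    rintro x y hxy ⟨p, hp⟩ he
    obtain ⟨u, v, w, hv, hw, i, j, hi, hj, rfl, rfl, hd⟩ :=
      walk_lemma (by omega) hG p (by omega)
    rw [hφ, hφ] at he
    replace he := hg _ _ _ _ _ _ he
    by_cases hvw : v = w
    · subst hvw
      rcases lt_trichotomy i j with h | h | h
      · have := Fgap u v i j hv h hj he
        omega
      · exact hxy (mkVert_congr _ _ _ h)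
      · have := Fgap u v j i hv h hi he.symm
        omega
    · have hs : i + j ≤ 2 * k + 1 := by
        rcases hd with hd | hd
        · omega
        · exact absurd hd.1 hvw
      have h0 : i = 0 ∧ j = 0 := by
        rcases le_total i j with h | h
        · exact Fstar u v w i j hv hw hvw h hj hs he
        · exact (Fstar u w v j i hw hv (Ne.symm hvw) h hi (by omega) he.symm).symm
      obtain ⟨rfl, rfl⟩ := h0
      exact hxy (mkVert_zero _ _)
  let C : (fracPower G (2 * k + 1) n).Coloring (Fin 4 ⊕ (Fin D × Fin k)) :=
    SimpleGraph.Coloring.mk (fun x => g (φ x)) (by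
      intro x y ha
      rw [fracPower, powerGraph, SimpleGraph.fromRel_adj] at ha
      rcases ha.2 with h | h
      · exact hwalk x y ha.1 h
      · exact (hwalk y x ha.1.symm h).symm)
  have := C.colorable
  simpa [Nat.add_comm, Nat.mul_comm] using this

theorem walk_along {V : Type*} [Fintype V] {G : SimpleGraph V} {n : ℕ} (hn : 0 < n) {u v : V}
    (h : G.Adj u v) (i t : ℕ) (hi : i + t ≤ n) :
    ∃ p : (subdivision G n).Walk (mkVert G n h i (by omega)) (mkVert G n h (i + t) hi),
      p.length = t := by
  induction t with
  | zero => exact ⟨SimpleGraph.Walk.nil, rfl⟩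
  | succ t ih =>
    obtain ⟨p, hp⟩ := ih (by omega)
    have ha : (subdivision G n).Adj (mkVert G n h (i + t) (by omega))
        (mkVert G n h (i + (t + 1)) hi) := by
      rw [subdivision, SimpleGraph.fromRel_adj]
      refine ⟨fun he => ?_, Or.inl ⟨u, v, h, i + t, by omega, rfl, rfl⟩⟩
      have := h.ne
      rcases mkVert_inv hn h h _ _ he with h | h | h | h | h | h
      · omega
      · exact this h.1
      · omega
      · exact this h.1.symm
      · exact this h.1
      · omega
    exact ⟨p.concat ha, by rw [SimpleGraph.Walk.length_concat, hp]⟩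

theorem clique_lower {V : Type*} [Fintype V] (G : SimpleGraph V) [DecidableRel G.Adj]
    (v : V) (hv : 1 ≤ G.degree v) (k n : ℕ) (hk : 1 ≤ k) (hn : 2 * k + 2 ≤ n) :
    k * G.degree v + 2 ≤ (fracPower G (2 * k + 1) n).cliqueNum := by
  classical
  obtain ⟨w₀, hw₀⟩ := (G.degree_pos_iff_exists_adj v).1 hv
  haveI : Finite (SubdivVert G n) := by
    haveI : Finite (SubdivPre G n) := by
      refine Finite.of_injective (β := V × V × Fin (n + 1))
        (fun p => (p.1.1, p.1.2.1, ⟨p.1.2.2, by rcases p.2 with h | h <;> omega⟩)) ?_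
      rintro ⟨⟨a, b, c⟩, _⟩ ⟨⟨a', b', c'⟩, _⟩ h
      simp only [Prod.mk.injEq, Fin.mk.injEq] at h
      obtain ⟨rfl, rfl, rfl⟩ := h
      rfl
    exact Quot.finite _
  let N : Fin 2 ⊕ (G.neighborSet v × Fin k) → G.neighborSet v × ℕ := fun x =>
    match x with
    | Sum.inl a => (⟨w₀, hw₀⟩, if a = 0 then 0 else k + 1)
    | Sum.inr (w, t) => (w, t.val + 1)
  have hN : ∀ x, (N x).2 ≤ k + 1 := by
    rintro (a | ⟨w, t⟩)
    · simp only [N]; split_ifs <;> omega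
    · simp only [N]; omega
  have hN2 : ∀ x y, x ≠ y → (N x).2 + (N y).2 ≤ 2 * k + 1 ∧ ((N x).2 ≠ 0 ∨ (N y).2 ≠ 0) ∧
      ((N x).1 = (N y).1 → (N x).2 ≠ (N y).2) := by
    rintro (a | ⟨w, t⟩) (a' | ⟨w', t'⟩) hne
    · simp only [N]
      fin_cases a <;> fin_cases a' <;> simp at hne ⊢ <;> omega
    · simp only [N]
      split_ifs <;> refine ⟨?_, ?_, fun _ => ?_⟩ <;> omega
    · simp only [N]
      split_ifs <;> refine ⟨?_, ?_, fun _ => ?_⟩ <;> omega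
    · simp only [N]
      refine ⟨by omega, by omega, fun h h' => hne ?_⟩
      rw [h, show t = t' from Fin.ext (by omega)]
  let g : Fin 2 ⊕ (G.neighborSet v × Fin k) → SubdivVert G n := fun x =>
    mkVert G n (N x).1.2 (N x).2 (by have := hN x; omega)
  have hne : ∀ x y, x ≠ y → g x ≠ g y := by
    intro x y hxy he
    obtain ⟨h1, h2, h3⟩ := hN2 x y hxy
    have hx := hN x
    have hy := hN y
    rcases mkVert_inv (by omega) _ _ _ _ he with h | h | h | h | h | h
    · exact h3 (Subtype.ext h.2.1) h.2.2
    all_goals omega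
  have hw : ∀ x y, x ≠ y → (fracPower G (2 * k + 1) n).Adj (g x) (g y) := by
    intro x y hxy
    obtain ⟨h1, h2, h3⟩ := hN2 x y hxy
    have hx := hN x
    have hy := hN y
    rw [fracPower, powerGraph, SimpleGraph.fromRel_adj]
    refine ⟨hne x y hxy, Or.inl ?_⟩
    obtain ⟨p, hp⟩ := walk_along (n := n) (by omega) (N x).1.2 0 (N x).2 (by omega)
    obtain ⟨p', hp'⟩ := walk_along (n := n) (by omega) (N y).1.2 0 (N y).2 (by omega)
    have e0 := mkVert_zero (n := n) (N x).1.2 (N y).1.2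
    have ex : mkVert G n (N x).1.2 (0 + (N x).2) (by omega) = g x :=
      mkVert_congr _ _ _ (by omega)
    have ey : mkVert G n (N y).1.2 (0 + (N y).2) (by omega) = g y :=
      mkVert_congr _ _ _ (by omega)
    refine ⟨((p.copy e0 ex).reverse).append (p'.copy rfl ey), ?_⟩
    simp [hp, hp']
    omega
  have hcl : (fracPower G (2 * k + 1) n).IsNClique (k * G.degree v + 2)
      (Finset.univ.image g) := by
    constructor
    · intro a ha b hb hab
      simp at ha hb
      obtain ⟨x, rfl⟩ : ∃ x, g x = a := by simpa using ha
      obtain ⟨y, rfl⟩ : ∃ y, g y = b := by simpa using hb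
      exact hw x y (fun h => hab (by rw [h]))
    · rw [Finset.card_image_of_injective _ (fun x y h => by
        by_contra hxy
        exact hne x y hxy h)]
      rw [Finset.card_univ, Fintype.card_sum, Fintype.card_prod,
        SimpleGraph.card_neighborSet_eq_degree, Fintype.card_fin, Fintype.card_fin]
      ring
  exact hcl.card_eq ▸ hcl.isClique.card_le_cliqueNum

end FracAux

theorem chromatic_le_clique_add_two_of_odd_power {V : Type*} [Fintype V] (G : SimpleGraph V)
    [DecidableRel G.Adj] (hconn : G.Connected) (hΔ : 4 ≤ G.maxDegree)
    (m n : ℕ) (hm : Odd m) (h1m : 1 < m) (hmn : m < n) :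
    (fracPower G m n).chromaticNumber ≤ (((fracPower G m n).cliqueNum + 2 : ℕ) : ℕ∞) := by
  obtain ⟨k, rfl⟩ := hm
  haveI := hconn.nonempty
  obtain ⟨v, hv⟩ := G.exists_maximal_degree_vertex
  have hG : ∀ u, ∃ w, G.Adj u w := by
    intro u
    obtain ⟨w, hw⟩ := (G.degree_pos_iff_exists_adj v).1 (by omega)
    by_cases h : u = v
    · exact ⟨w, h ▸ hw⟩
    · obtain ⟨p⟩ := hconn.preconnected u v
      cases p with
      | nil => exact absurd rfl h
      | cons ha _ => exact ⟨_, ha⟩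
  have h1 := coloring_upper G hG G.maxDegree hΔ G.degree_le_maxDegree k n (by omega) (by omega)
  have h2 := clique_lower G v (by omega) k n (by omega) (by omega)
  rw [← hv] at h2
  exact (h1.mono (by omega)).chromaticNumber_le
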